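/- Completeness of ctACPps: for all closed ctACPps process terms p and q, if p ↔ q (p and q are bisimulation equivalent) then the equation p = q is derivable from the axioms of ctACPps. -/

import Mathlib

set_option autoImplicit true
set_option maxHeartbeats 1000000

/-- The three truth values of LP→⊥: true, false, both. -/
inductive V3 : Type
  | t
  | f
  | b
  deriving DecidableEq

/-- Formulas of LP→⊥ over propositional variables of type `α`. -/
inductive Fml (α : Type) : Type
  | var : α → Fml α
  | bot : Fml α
  | neg : Fml α → Fml α
  | conj : Fml α → Fml α → Fml α
  | disj : Fml α → Fml α → Fml α
  | imp : Fml α → Fml α → Fml α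

namespace Fml

/-- ⊤ abbreviates ¬⊥. -/
def top {α : Type} : Fml α := neg bot

/-- A↔B abbreviates (A→B)∧(B→A). -/
def iff' {α : Type} (A B : Fml α) : Fml α := conj (imp A B) (imp B A)

end Fml

/-- LP→⊥ truth table for negation. -/
def negT : V3 → V3
  | .f => .t
  | .t => .f
  | .b => .b

/-- LP→⊥ truth table for conjunction. -/
def conjT : V3 → V3 → V3
  | .f, _ => .f
  | _, .f => .f
  | .t, .t => .t
  | _, _ => .b

/-- LP→⊥ truth table for disjunction. -/
def disjT : V3 → V3 → V3
  | .t, _ => .t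
  | _, .t => .t
  | .f, .f => .f
  | _, _ => .b

/-- LP→⊥ truth table for implication. -/
def impT : V3 → V3 → V3
  | .f, _ => .t
  | _, y => y

/-- The LP→⊥ valuation determined by an assignment `σ` of truth values to variables. -/
def eval {α : Type} (σ : α → V3) : Fml α → V3
  | .var x => σ x
  | .bot => .f
  | .neg A => negT (eval σ A)
  | .conj A B => conjT (eval σ A) (eval σ B)
  | .disj A B => disjT (eval σ A) (eval σ B)
  | .imp A B => impT (eval σ A) (eval σ B)

/-- Logical equivalence in LP→⊥: the same value under every valuation. -/
def FEquiv {α : Type} (A B : Fml α) : Prop := ∀ σ : α → V3, eval σ A = eval σ B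

/-- `φ ∈ [⊥]`: `φ` is logically equivalent to ⊥. -/
def EqBot {α : Type} (φ : Fml α) : Prop := ∀ σ : α → V3, eval σ φ = V3.f

/-- Semantic consequence in LP→⊥ (designated values t and b). -/
def SemCons {α : Type} (Γ : Set (Fml α)) (A : Fml α) : Prop :=
  ∀ σ : α → V3, (∀ C ∈ Γ, eval σ C ≠ V3.f) → eval σ A ≠ V3.f

/-- The Hilbert system of LP→⊥, with hypotheses `Γ`. -/
inductive Hilb {α : Type} (Γ : Set (Fml α)) : Fml α → Prop
  | hyp {A : Fml α} : A ∈ Γ → Hilb Γ A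
  | mp {A B : Fml α} : Hilb Γ (A.imp B) → Hilb Γ A → Hilb Γ B
  | ax1 (A B : Fml α) : Hilb Γ (A.imp (B.imp A))
  | ax2 (A B C : Fml α) : Hilb Γ ((A.imp (B.imp C)).imp ((A.imp B).imp (A.imp C)))
  | ax3 (A B : Fml α) : Hilb Γ (((A.imp B).imp A).imp A)
  | ax4 (A : Fml α) : Hilb Γ (Fml.bot.imp A)
  | ax5 (A B : Fml α) : Hilb Γ ((A.conj B).imp A)
  | ax6 (A B : Fml α) : Hilb Γ ((A.conj B).imp B)
  | ax7 (A B : Fml α) : Hilb Γ (A.imp (B.imp (A.conj B)))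
  | ax8 (A B : Fml α) : Hilb Γ (A.imp (A.disj B))
  | ax9 (A B : Fml α) : Hilb Γ (B.imp (A.disj B))
  | ax10 (A B C : Fml α) : Hilb Γ ((A.imp C).imp ((B.imp C).imp ((A.disj B).imp C)))
  | ax11 (A : Fml α) : Hilb Γ (Fml.iff' A.neg.neg A)
  | ax12 (A B : Fml α) : Hilb Γ (Fml.iff' (A.imp B).neg (A.conj B.neg))
  | ax13 (A B : Fml α) : Hilb Γ (Fml.iff' (A.conj B).neg (A.neg.disj B.neg))
  | ax14 (A B : Fml α) : Hilb Γ (Fml.iff' (A.disj B).neg (A.neg.conj B.neg))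
  | ax15 (A : Fml α) : Hilb Γ (A.disj A.neg)

/-- The internalization (A↔B)∧(¬A↔¬B) of logical equivalence. -/
def InternEq {α : Type} (φ ψ : Fml α) : Fml α :=
  (Fml.iff' φ ψ).conj (Fml.iff' φ.neg ψ.neg)

/-- Derivable equality of propositions: the least congruence containing the
instances of axiom IMP (φ = ψ whenever ⊢ (φ↔ψ)∧(¬φ↔¬ψ)). -/
inductive PropEq {α : Type} : Fml α → Fml α → Prop
  | imp {φ ψ} : Hilb (∅ : Set (Fml α)) (InternEq φ ψ) → PropEq φ ψ
  | refl (φ) : PropEq φ φ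
  | symm {φ ψ} : PropEq φ ψ → PropEq ψ φ
  | trans {φ ψ χ} : PropEq φ ψ → PropEq ψ χ → PropEq φ χ
  | negC {φ ψ} : PropEq φ ψ → PropEq φ.neg ψ.neg
  | conjC {φ ψ φ' ψ'} : PropEq φ ψ → PropEq φ' ψ' → PropEq (φ.conj φ') (ψ.conj ψ')
  | disjC {φ ψ φ' ψ'} : PropEq φ ψ → PropEq φ' ψ' → PropEq (φ.disj φ') (ψ.disj ψ')
  | impC {φ ψ φ' ψ'} : PropEq φ ψ → PropEq φ' ψ' → PropEq (φ.imp φ') (ψ.imp ψ')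

/-- Closed ctACPps process terms (δ is `delta`, ⊗ is `nex`, `gc`/`se` are the
guarded command and signal emission, `par` is ∥, `lm` is left merge ⌊⌊,
`cm` is communication merge |, `encap H` is ∂_H). -/
inductive APT (α Act : Type) : Type
  | act : Act → APT α Act
  | delta : APT α Act
  | nex : APT α Act
  | alt : APT α Act → APT α Act → APT α Act
  | seq : APT α Act → APT α Act → APT α Act
  | gc : Fml α → APT α Act → APT α Act
  | se : Fml α → APT α Act → APT α Act
  | par : APT α Act → APT α Act → APT α Act
  | lm : APT α Act → APT α Act → APT α Act
  | cm : APT α Act → APT α Act → APT α Act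
  | encap : Set Act → APT α Act → APT α Act

/-- The constant corresponding to an element of A ∪ {δ} (encoded as `Option Act`,
with `none` standing for δ). -/
def actd {α Act : Type} : Option Act → APT α Act
  | some a => .act a
  | none => .delta

section
variable {α Act : Type}

/-- Derivable equality from the axioms of ctACPps (γ is the communication
function on A ∪ {δ}; `a | b` in the axioms stands for γ(a,b), which is the
content of axiom `CF`): the least congruence satisfying A1-A7, NE1-NE3,
GC1-GC7, SE1-SE8, IMP, CM1-CM9 (with CM2S, CM3S), C1-C3, D1-D4,
GC8S-GC11 and SE9-SE12. -/
inductive ADeriv (γ : Option Act → Option Act → Option Act) :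
    APT α Act → APT α Act → Prop
  | refl (p : APT α Act) : ADeriv γ p p
  | symm {p q} : ADeriv γ p q → ADeriv γ q p
  | trans {p q r} : ADeriv γ p q → ADeriv γ q r → ADeriv γ p r
  | altC {p q p' q'} : ADeriv γ p q → ADeriv γ p' q' → ADeriv γ (.alt p p') (.alt q q')
  | seqC {p q p' q'} : ADeriv γ p q → ADeriv γ p' q' → ADeriv γ (.seq p p') (.seq q q')
  | gcC {φ ψ p q} : PropEq φ ψ → ADeriv γ p q → ADeriv γ (.gc φ p) (.gc ψ q)
  | seC {φ ψ p q} : PropEq φ ψ → ADeriv γ p q → ADeriv γ (.se φ p) (.se ψ q)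
  | parC {p q p' q'} : ADeriv γ p q → ADeriv γ p' q' → ADeriv γ (.par p p') (.par q q')
  | lmC {p q p' q'} : ADeriv γ p q → ADeriv γ p' q' → ADeriv γ (.lm p p') (.lm q q')
  | cmC {p q p' q'} : ADeriv γ p q → ADeriv γ p' q' → ADeriv γ (.cm p p') (.cm q q')
  | encapC (H : Set Act) {p q} : ADeriv γ p q → ADeriv γ (.encap H p) (.encap H q)
  | A1 (x y : APT α Act) : ADeriv γ (.alt x y) (.alt y x)
  | A2 (x y z : APT α Act) : ADeriv γ (.alt (.alt x y) z) (.alt x (.alt y z))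
  | A3 (x : APT α Act) : ADeriv γ (.alt x x) x
  | A4 (x y z : APT α Act) : ADeriv γ (.seq (.alt x y) z) (.alt (.seq x z) (.seq y z))
  | A5 (x y z : APT α Act) : ADeriv γ (.seq (.seq x y) z) (.seq x (.seq y z))
  | A6 (x : APT α Act) : ADeriv γ (.alt x .delta) x
  | A7 (x : APT α Act) : ADeriv γ (.seq .delta x) .delta
  | NE1 (x : APT α Act) : ADeriv γ (.alt x .nex) .nex
  | NE2 (x : APT α Act) : ADeriv γ (.seq .nex x) .nex
  | NE3 (a : Option Act) : ADeriv γ (.seq (actd a) .nex) (.delta : APT α Act)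
  | GC1 (x : APT α Act) : ADeriv γ (.gc Fml.top x) x
  | GC2 (x : APT α Act) : ADeriv γ (.gc .bot x) .delta
  | GC3 (φ : Fml α) : ADeriv γ (.gc φ .delta) (.delta : APT α Act)
  | GC4 (φ : Fml α) (x y : APT α Act) :
      ADeriv γ (.gc φ (.alt x y)) (.alt (.gc φ x) (.gc φ y))
  | GC5 (φ : Fml α) (x y : APT α Act) : ADeriv γ (.gc φ (.seq x y)) (.seq (.gc φ x) y)
  | GC6 (φ ψ : Fml α) (x : APT α Act) : ADeriv γ (.gc φ (.gc ψ x)) (.gc (φ.conj ψ) x)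
  | GC7 (φ ψ : Fml α) (x : APT α Act) :
      ADeriv γ (.gc (φ.disj ψ) x) (.alt (.gc φ x) (.gc ψ x))
  | SE1 (x : APT α Act) : ADeriv γ (.se Fml.top x) x
  | SE2 (x : APT α Act) : ADeriv γ (.se .bot x) .nex
  | SE3 (φ : Fml α) : ADeriv γ (.se φ .nex) (.nex : APT α Act)
  | SE4 (φ : Fml α) (x y : APT α Act) : ADeriv γ (.alt (.se φ x) y) (.se φ (.alt x y))
  | SE5 (φ : Fml α) (x y : APT α Act) : ADeriv γ (.seq (.se φ x) y) (.se φ (.seq x y))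
  | SE6 (φ ψ : Fml α) (x : APT α Act) : ADeriv γ (.se φ (.se ψ x)) (.se (φ.conj ψ) x)
  | SE7 (φ : Fml α) (x : APT α Act) : ADeriv γ (.se φ (.gc φ x)) (.se φ x)
  | SE8 (φ ψ : Fml α) (x : APT α Act) :
      ADeriv γ (.gc φ (.se ψ x)) (.se (φ.imp ψ) (.gc φ x))
  | CM1 (x y : APT α Act) :
      ADeriv γ (.par x y) (.alt (.alt (.lm x y) (.lm y x)) (.cm x y))
  | CM2S (a : Option Act) (x : APT α Act) :
      ADeriv γ (.lm (actd a) x) (.alt (.seq (actd a) x) (.encap Set.univ x))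
  | CM3S (a : Option Act) (x y : APT α Act) :
      ADeriv γ (.lm (.seq (actd a) x) y)
        (.alt (.seq (actd a) (.par x y)) (.encap Set.univ y))
  | CM4 (x y z : APT α Act) : ADeriv γ (.lm (.alt x y) z) (.alt (.lm x z) (.lm y z))
  | CM5 (a b : Option Act) (x : APT α Act) :
      ADeriv γ (.cm (.seq (actd a) x) (actd b)) (.seq (actd (γ a b)) x)
  | CM6 (a b : Option Act) (x : APT α Act) :
      ADeriv γ (.cm (actd a) (.seq (actd b) x)) (.seq (actd (γ a b)) x)
  | CM7 (a b : Option Act) (x y : APT α Act) :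
      ADeriv γ (.cm (.seq (actd a) x) (.seq (actd b) y)) (.seq (actd (γ a b)) (.par x y))
  | CM8 (x y z : APT α Act) : ADeriv γ (.cm (.alt x y) z) (.alt (.cm x z) (.cm y z))
  | CM9 (x y z : APT α Act) : ADeriv γ (.cm x (.alt y z)) (.alt (.cm x y) (.cm x z))
  | CF (a b : Option Act) : ADeriv γ (.cm (actd a) (actd b)) (actd (γ a b) : APT α Act)
  | C1 (a b : Option Act) :
      ADeriv γ (.cm (actd a) (actd b)) (.cm (actd b) (actd a) : APT α Act)
  | C2 (a b c : Option Act) :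
      ADeriv γ (.cm (.cm (actd a) (actd b)) (actd c))
        (.cm (actd a) (.cm (actd b) (actd c)) : APT α Act)
  | C3 (a : Option Act) : ADeriv γ (.cm .delta (actd a)) (.delta : APT α Act)
  | D1 (H : Set Act) (a : Act) : a ∉ H → ADeriv γ (.encap H (.act a)) (.act a)
  | D1d (H : Set Act) : ADeriv γ (.encap H (.delta : APT α Act)) .delta
  | D2 (H : Set Act) (a : Act) : a ∈ H → ADeriv γ (.encap H (.act a)) .delta
  | D3 (H : Set Act) (x y : APT α Act) :
      ADeriv γ (.encap H (.alt x y)) (.alt (.encap H x) (.encap H y))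
  | D4 (H : Set Act) (x y : APT α Act) :
      ADeriv γ (.encap H (.seq x y)) (.seq (.encap H x) (.encap H y))
  | GC8S (φ : Fml α) (x y : APT α Act) :
      ADeriv γ (.lm (.gc φ x) y) (.alt (.gc φ (.lm x y)) (.encap Set.univ y))
  | GC9S (φ : Fml α) (x y : APT α Act) :
      ADeriv γ (.cm (.gc φ x) y) (.alt (.gc φ (.cm x y)) (.encap Set.univ y))
  | GC10S (φ : Fml α) (x y : APT α Act) :
      ADeriv γ (.cm x (.gc φ y)) (.alt (.gc φ (.cm x y)) (.encap Set.univ x))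
  | GC11 (H : Set Act) (φ : Fml α) (x : APT α Act) :
      ADeriv γ (.encap H (.gc φ x)) (.gc φ (.encap H x))
  | SE9 (φ : Fml α) (x y : APT α Act) : ADeriv γ (.lm (.se φ x) y) (.se φ (.lm x y))
  | SE10 (φ : Fml α) (x y : APT α Act) : ADeriv γ (.cm (.se φ x) y) (.se φ (.cm x y))
  | SE11 (φ : Fml α) (x y : APT α Act) : ADeriv γ (.cm x (.se φ y)) (.se φ (.cm x y))
  | SE12 (H : Set Act) (φ : Fml α) (x : APT α Act) :
      ADeriv γ (.encap H (.se φ x)) (.se φ (.encap H x))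

/-- Basic terms (basic terms of ctBPAps, within the ctACPps syntax). -/
inductive ABasic : APT α Act → Prop
  | nex : ABasic (.nex : APT α Act)
  | emiDelta {φ : Fml α} : ¬ EqBot φ → ABasic (.se φ .delta)
  | gcAct {φ : Fml α} (a : Act) : ¬ EqBot φ → ABasic (.gc φ (.act a))
  | gcSeq {φ : Fml α} (a : Act) {p : APT α Act} :
      ¬ EqBot φ → ABasic p → ABasic (.gc φ (.seq (.act a) p))
  | alt {p q : APT α Act} : ABasic p → ABasic q → ABasic (.alt p q)

/-- The signal (root signal) emitted by a process term. -/
def sigA : APT α Act → Fml α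
  | .act _ => Fml.top
  | .delta => Fml.top
  | .nex => .bot
  | .alt p q => (sigA p).conj (sigA q)
  | .seq p _ => sigA p
  | .gc φ p => φ.imp (sigA p)
  | .se φ p => φ.conj (sigA p)
  | .par p q => (sigA p).conj (sigA q)
  | .lm p q => (sigA p).conj (sigA q)
  | .cm p q => (sigA p).conj (sigA q)
  | .encap _ p => sigA p

/-- The structural operational semantics of ctACPps: `ATr γ p φ a (some q)` is the
action step p –φ,a→ q and `ATr γ p φ a none` is the action termination p –φ,a→ √. -/
inductive ATr (γ : Option Act → Option Act → Option Act) :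
    APT α Act → Fml α → Act → Option (APT α Act) → Prop
  | act (a : Act) : ATr γ (.act a) Fml.top a none
  | altL {x φ a o} (y : APT α Act) :
      ATr γ x φ a o → ¬ EqBot (sigA (APT.alt x y)) → ATr γ (.alt x y) φ a o
  | altR {y φ a o} (x : APT α Act) :
      ATr γ y φ a o → ¬ EqBot (sigA (APT.alt x y)) → ATr γ (.alt x y) φ a o
  | seqT {x φ a} (y : APT α Act) :
      ATr γ x φ a none → ¬ EqBot (sigA y) → ATr γ (.seq x y) φ a (some y)
  | seqS {x φ a x'} (y : APT α Act) :
      ATr γ x φ a (some x') → ATr γ (.seq x y) φ a (some (.seq x' y))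
  | gcR {x φ a o} (ψ : Fml α) :
      ATr γ x φ a o → ¬ EqBot (φ.conj ψ) → ATr γ (.gc ψ x) (φ.conj ψ) a o
  | seR {x φ a o} (ψ : Fml α) :
      ATr γ x φ a o → ¬ EqBot (sigA (APT.se ψ x)) → ATr γ (.se ψ x) φ a o
  | parTL {x φ a} (y : APT α Act) :
      ATr γ x φ a none → ¬ EqBot (sigA (APT.par x y)) → ¬ EqBot (sigA y) →
      ATr γ (.par x y) φ a (some y)
  | parTR (x : APT α Act) {y φ a} :
      ATr γ y φ a none → ¬ EqBot (sigA (APT.par x y)) → ¬ EqBot (sigA x) →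
      ATr γ (.par x y) φ a (some x)
  | parSL {x φ a x'} (y : APT α Act) :
      ATr γ x φ a (some x') → ¬ EqBot (sigA (APT.par x y)) →
      ¬ EqBot (sigA (APT.par x' y)) → ATr γ (.par x y) φ a (some (.par x' y))
  | parSR (x : APT α Act) {y φ a y'} :
      ATr γ y φ a (some y') → ¬ EqBot (sigA (APT.par x y)) →
      ¬ EqBot (sigA (APT.par x y')) → ATr γ (.par x y) φ a (some (.par x y'))
  | parCTT {x y : APT α Act} {φ ψ a b c} :
      ATr γ x φ a none → ATr γ y ψ b none → γ (some a) (some b) = some c →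
      ¬ EqBot (φ.conj ψ) → ¬ EqBot (sigA (APT.par x y)) →
      ATr γ (.par x y) (φ.conj ψ) c none
  | parCTS {x y : APT α Act} {φ ψ a b c y'} :
      ATr γ x φ a none → ATr γ y ψ b (some y') → γ (some a) (some b) = some c →
      ¬ EqBot (φ.conj ψ) → ¬ EqBot (sigA (APT.par x y)) →
      ATr γ (.par x y) (φ.conj ψ) c (some y')
  | parCST {x y : APT α Act} {φ ψ a b c x'} :
      ATr γ x φ a (some x') → ATr γ y ψ b none → γ (some a) (some b) = some c →
      ¬ EqBot (φ.conj ψ) → ¬ EqBot (sigA (APT.par x y)) →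
      ATr γ (.par x y) (φ.conj ψ) c (some x')
  | parCSS {x y : APT α Act} {φ ψ a b c x' y'} :
      ATr γ x φ a (some x') → ATr γ y ψ b (some y') → γ (some a) (some b) = some c →
      ¬ EqBot (φ.conj ψ) → ¬ EqBot (sigA (APT.par x y)) →
      ¬ EqBot (sigA (APT.par x' y')) →
      ATr γ (.par x y) (φ.conj ψ) c (some (.par x' y'))
  | lmT {x φ a} (y : APT α Act) :
      ATr γ x φ a none → ¬ EqBot (sigA (APT.lm x y)) → ¬ EqBot (sigA y) →
      ATr γ (.lm x y) φ a (some y)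
  | lmS {x φ a x'} (y : APT α Act) :
      ATr γ x φ a (some x') → ¬ EqBot (sigA (APT.lm x y)) →
      ¬ EqBot (sigA (APT.par x' y)) → ATr γ (.lm x y) φ a (some (.par x' y))
  | cmTT {x y : APT α Act} {φ ψ a b c} :
      ATr γ x φ a none → ATr γ y ψ b none → γ (some a) (some b) = some c →
      ¬ EqBot (φ.conj ψ) → ¬ EqBot (sigA (APT.cm x y)) →
      ATr γ (.cm x y) (φ.conj ψ) c none
  | cmTS {x y : APT α Act} {φ ψ a b c y'} :
      ATr γ x φ a none → ATr γ y ψ b (some y') → γ (some a) (some b) = some c →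
      ¬ EqBot (φ.conj ψ) → ¬ EqBot (sigA (APT.cm x y)) →
      ATr γ (.cm x y) (φ.conj ψ) c (some y')
  | cmST {x y : APT α Act} {φ ψ a b c x'} :
      ATr γ x φ a (some x') → ATr γ y ψ b none → γ (some a) (some b) = some c →
      ¬ EqBot (φ.conj ψ) → ¬ EqBot (sigA (APT.cm x y)) →
      ATr γ (.cm x y) (φ.conj ψ) c (some x')
  | cmSS {x y : APT α Act} {φ ψ a b c x' y'} :
      ATr γ x φ a (some x') → ATr γ y ψ b (some y') → γ (some a) (some b) = some c →
      ¬ EqBot (φ.conj ψ) → ¬ EqBot (sigA (APT.cm x y)) →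
      ¬ EqBot (sigA (APT.par x' y')) →
      ATr γ (.cm x y) (φ.conj ψ) c (some (.par x' y'))
  | encapR {x φ a o} (H : Set Act) :
      ATr γ x φ a o → a ∉ H → ATr γ (.encap H x) φ a (Option.map (APT.encap H) o)

/-- Lift a relation on process terms to their optional (√-extended) targets. -/
def AOptR (R : APT α Act → APT α Act → Prop) :
    Option (APT α Act) → Option (APT α Act) → Prop
  | none, none => True
  | some p, some q => R p q
  | _, _ => False

/-- The (one-directional) simulation conditions of a splitting bisimulation. -/
def ASim (γ : Option Act → Option Act → Option Act)
    (R : APT α Act → APT α Act → Prop) (p q : APT α Act) : Prop :=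
  (∀ φ a o, ATr γ p φ a o →
    ∀ σ : α → V3, eval σ (sigA p) ≠ V3.f → eval σ φ ≠ V3.f →
      ∃ ψ o', eval σ ψ = eval σ φ ∧ ATr γ q ψ a o' ∧ AOptR R o o') ∧
  FEquiv (sigA p) (sigA q)

/-- `R` is a bisimulation. -/
def AIsBisim (γ : Option Act → Option Act → Option Act)
    (R : APT α Act → APT α Act → Prop) : Prop :=
  ∀ p q, R p q → ASim γ R p q ∧ ASim γ (fun u v => R v u) q p

/-- Bisimulation equivalence. -/
def ABisim (γ : Option Act → Option Act → Option Act) (p q : APT α Act) : Prop :=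
  ∃ R, AIsBisim γ R ∧ R p q

end

namespace Hilb

variable {α : Type} {Γ Δ : Set (Fml α)} {A B C : Fml α}

/-- Induction on derivations that treats all axiom schemas uniformly. -/
theorem closure_induction {P : Fml α → Prop} (hyp : ∀ B ∈ Γ, P B)
    (mp : ∀ B C, P (B.imp C) → P B → P C) (ax : ∀ B, (∀ Δ, Hilb Δ B) → P B)
    (h : Hilb Γ A) : P A := by
  induction h with
  | hyp h => exact hyp _ h
  | mp _ _ ih₁ ih₂ => exact mp _ _ ih₁ ih₂
  | ax1 => exact ax _ fun _ => .ax1 _ _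
  | ax2 => exact ax _ fun _ => .ax2 _ _ _
  | ax3 => exact ax _ fun _ => .ax3 _ _
  | ax4 => exact ax _ fun _ => .ax4 _
  | ax5 => exact ax _ fun _ => .ax5 _ _
  | ax6 => exact ax _ fun _ => .ax6 _ _
  | ax7 => exact ax _ fun _ => .ax7 _ _
  | ax8 => exact ax _ fun _ => .ax8 _ _
  | ax9 => exact ax _ fun _ => .ax9 _ _
  | ax10 => exact ax _ fun _ => .ax10 _ _ _
  | ax11 => exact ax _ fun _ => .ax11 _
  | ax12 => exact ax _ fun _ => .ax12 _ _
  | ax13 => exact ax _ fun _ => .ax13 _ _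
  | ax14 => exact ax _ fun _ => .ax14 _ _
  | ax15 => exact ax _ fun _ => .ax15 _

theorem imp_self (A : Fml α) : Hilb Γ (A.imp A) :=
  .mp (.mp (.ax2 A (A.imp A) A) (.ax1 _ _)) (.ax1 _ _)

theorem weaken (h : Hilb Γ B) : Hilb Γ (A.imp B) := .mp (.ax1 _ _) h

/-- The deduction theorem. -/
theorem deduction (h : Hilb (insert A Γ) B) : Hilb Γ (A.imp B) := by
  refine closure_induction (P := fun B => Hilb Γ (A.imp B)) ?_
    (fun _ _ h₁ h₂ => .mp (.mp (.ax2 _ _ _) h₁) h₂) (fun _ h => weaken (h Γ)) h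
  rintro B (rfl | hB)
  · exact imp_self _
  · exact weaken (.hyp hB)

theorem mono (hs : Γ ⊆ Δ) (h : Hilb Γ A) : Hilb Δ A :=
  closure_induction (P := Hilb Δ) (fun _ hB => .hyp (hs hB)) (fun _ _ => .mp) (fun _ h => h Δ) h

/-- A derivation uses finitely many hypotheses. -/
theorem exists_finite (h : Hilb Γ A) : ∃ Δ ⊆ Γ, Δ.Finite ∧ Hilb Δ A := by
  refine closure_induction (P := fun A => ∃ Δ ⊆ Γ, Δ.Finite ∧ Hilb Δ A)
    (fun B hB => ⟨{B}, by simpa using hB, Set.finite_singleton B, .hyp rfl⟩) ?_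
    (fun _ h => ⟨∅, Set.empty_subset _, Set.finite_empty, h ∅⟩) h
  rintro B C ⟨Δ₁, hs₁, hf₁, h₁⟩ ⟨Δ₂, hs₂, hf₂, h₂⟩
  exact ⟨Δ₁ ∪ Δ₂, Set.union_subset hs₁ hs₂, hf₁.union hf₂,
    .mp (h₁.mono Set.subset_union_left) (h₂.mono Set.subset_union_right)⟩

/-- `Γ` is maximal among the sets of formulas from which `A` is not derivable. -/
def MaxAvoiding (Γ : Set (Fml α)) (A : Fml α) : Prop :=
  ¬ Hilb Γ A ∧ ∀ B, B ∉ Γ → Hilb (insert B Γ) A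

theorem exists_maxAvoiding (h : ¬ Hilb Δ A) : ∃ Γ, MaxAvoiding Γ A := by
  obtain ⟨Γ, -, hΓ⟩ := zorn_subset_nonempty {Γ : Set (Fml α) | ¬ Hilb Γ A}
    (fun c hc hch hne => ⟨⋃₀ c, fun hA => by
      obtain ⟨Δ, hs, hf, hd⟩ := exists_finite hA
      obtain ⟨s, hsc, hΔs⟩ := hch.directedOn.exists_mem_subset_of_finite_of_subset_sUnion
        hne hf hs
      exact hc hsc (hd.mono hΔs), fun s hs => Set.subset_sUnion_of_mem hs⟩) Δ h
  refine ⟨Γ, hΓ.prop, fun B hB => ?_⟩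
  by_contra hn
  exact hB (hΓ.le_of_ge hn (Set.subset_insert B Γ) (Set.mem_insert B Γ))

namespace MaxAvoiding

theorem imp_of_notMem (m : MaxAvoiding Γ A) (hB : B ∉ Γ) : Hilb Γ (B.imp A) :=
  deduction (m.2 B hB)

theorem mem_of_hilb (m : MaxAvoiding Γ A) (h : Hilb Γ B) : B ∈ Γ := by
  by_contra hB
  exact m.1 (.mp (m.imp_of_notMem hB) h)

theorem mp_mem (m : MaxAvoiding Γ A) (h : B.imp C ∈ Γ) (hB : B ∈ Γ) : C ∈ Γ :=
  m.mem_of_hilb (.mp (.hyp h) (.hyp hB))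

theorem conj_mem_iff (m : MaxAvoiding Γ A) : B.conj C ∈ Γ ↔ B ∈ Γ ∧ C ∈ Γ :=
  ⟨fun h => ⟨m.mem_of_hilb (.mp (.ax5 _ _) (.hyp h)), m.mem_of_hilb (.mp (.ax6 _ _) (.hyp h))⟩,
    fun h => m.mem_of_hilb (.mp (.mp (.ax7 _ _) (.hyp h.1)) (.hyp h.2))⟩

theorem disj_mem_iff (m : MaxAvoiding Γ A) : B.disj C ∈ Γ ↔ B ∈ Γ ∨ C ∈ Γ := by
  refine ⟨fun h => ?_, fun h => ?_⟩
  · by_contra! hn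
    exact m.1 (.mp (.mp (.mp (.ax10 _ _ _) (m.imp_of_notMem hn.1)) (m.imp_of_notMem hn.2)) (.hyp h))
  · rcases h with h | h
    · exact m.mem_of_hilb (.mp (.ax8 _ _) (.hyp h))
    · exact m.mem_of_hilb (.mp (.ax9 _ _) (.hyp h))

theorem imp_mem_iff (m : MaxAvoiding Γ A) : B.imp C ∈ Γ ↔ (B ∈ Γ → C ∈ Γ) := by
  refine ⟨m.mp_mem, fun h => ?_⟩
  by_cases hB : B ∈ Γ
  · exact m.mem_of_hilb (weaken (.hyp (h hB)))
  by_contra hn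
  refine m.1 (.mp (.ax3 A C) (deduction
    (.mp ((m.imp_of_notMem hn).mono (Set.subset_insert _ _)) ?_)))
  refine deduction (.mp (.hyp (Set.mem_insert_of_mem _ (Set.mem_insert _ _))) ?_)
  exact .mp ((m.imp_of_notMem hB).mono
    ((Set.subset_insert _ _).trans (Set.subset_insert _ _))) (.hyp (Set.mem_insert _ _))

theorem mem_iff_of_iff (m : MaxAvoiding Γ A) (h : Hilb Γ (B.iff' C)) : B ∈ Γ ↔ C ∈ Γ := by
  have h := m.conj_mem_iff.1 (m.mem_of_hilb h)
  exact ⟨m.mp_mem h.1, m.mp_mem h.2⟩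

theorem bot_notMem (m : MaxAvoiding Γ A) : Fml.bot ∉ Γ :=
  fun h => m.1 (.mp (.ax4 A) (.hyp h))

/-- `Γ` contains a formula or its negation. -/
theorem mem_or_neg_mem (m : MaxAvoiding Γ A) (B : Fml α) : B ∈ Γ ∨ B.neg ∈ Γ :=
  m.disj_mem_iff.1 (m.mem_of_hilb (.ax15 B))

end MaxAvoiding

open Classical in
/-- The valuation that makes exactly the variables and negated variables in `Γ` designated. -/
noncomputable def canonicalVal (Γ : Set (Fml α)) (x : α) : V3 :=
  if Fml.var x ∈ Γ then if (Fml.var x).neg ∈ Γ then .b else .t else .f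

theorem truth_lemma (m : MaxAvoiding Γ A) (B : Fml α) :
    (B ∈ Γ ↔ eval (canonicalVal Γ) B ≠ .f) ∧ (B.neg ∈ Γ ↔ eval (canonicalVal Γ) B ≠ .t) := by
  induction B with
  | var x =>
    have := m.mem_or_neg_mem (.var x)
    simp only [eval, canonicalVal]
    split_ifs <;> simp_all
  | bot =>
    have := m.mem_or_neg_mem .bot
    have := m.bot_notMem
    simp_all [eval]
  | neg B ih =>
    rw [m.mem_iff_of_iff (.ax11 B), ih.1, ih.2, eval]
    cases eval (canonicalVal Γ) B <;> simp [negT]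
  | conj B C ihB ihC =>
    rw [m.mem_iff_of_iff (.ax13 B C), m.conj_mem_iff, m.disj_mem_iff, ihB.1, ihB.2, ihC.1, ihC.2,
      eval]
    cases eval (canonicalVal Γ) B <;> cases eval (canonicalVal Γ) C <;> simp [conjT]
  | disj B C ihB ihC =>
    rw [m.mem_iff_of_iff (.ax14 B C), m.conj_mem_iff, m.disj_mem_iff, ihB.1, ihB.2, ihC.1, ihC.2,
      eval]
    cases eval (canonicalVal Γ) B <;> cases eval (canonicalVal Γ) C <;> simp [disjT]
  | imp B C ihB ihC =>
    rw [m.mem_iff_of_iff (.ax12 B C), m.conj_mem_iff, m.imp_mem_iff, ihB.1, ihC.1, ihC.2, eval]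
    cases eval (canonicalVal Γ) B <;> cases eval (canonicalVal Γ) C <;> simp [impT]

/-- Completeness of the Hilbert system for LP→⊥. -/
theorem complete (h : ∀ σ, eval σ A ≠ .f) : Hilb ∅ A := by
  by_contra hn
  obtain ⟨Γ, m⟩ := exists_maxAvoiding hn
  exact m.1 (.hyp ((truth_lemma m A).1.2 (h _)))

end Hilb

theorem PropEq.of_fequiv {α : Type} {φ ψ : Fml α} (h : FEquiv φ ψ) : PropEq φ ψ := by
  refine .imp (Hilb.complete fun σ => ?_)
  simp only [InternEq, Fml.iff', eval, h σ]
  cases eval σ ψ <;> simp [negT, conjT, impT]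

/-- Derivable equality as a setoid. -/
def derivSetoid (α : Type) {Act : Type} (γ : Option Act → Option Act → Option Act) :
    Setoid (APT α Act) :=
  ⟨ADeriv γ, .refl, .symm, .trans⟩

/-- Closed process terms modulo derivable equality. -/
def PCls (α : Type) {Act : Type} (γ : Option Act → Option Act → Option Act) : Type :=
  Quotient (derivSetoid α γ)

namespace PCls

variable {α Act : Type} {γ : Option Act → Option Act → Option Act}

/-- The class of a process term. -/
def mk (γ : Option Act → Option Act → Option Act) (p : APT α Act) : PCls α γ :=
  Quotient.mk (derivSetoid α γ) p

theorem mk_eq_mk {p q : APT α Act} : mk γ p = mk γ q ↔ ADeriv γ p q :=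
  Quotient.eq (r := derivSetoid α γ)

theorem sound {p q : APT α Act} (h : ADeriv γ p q) : mk γ p = mk γ q := mk_eq_mk.2 h

/-- Alternative composition is the join. -/
instance : SemilatticeSup (PCls α γ) :=
  letI : Max (PCls α γ) :=
    ⟨Quotient.map₂ APT.alt fun _ _ h₁ _ _ h₂ => ADeriv.altC h₁ h₂⟩
  SemilatticeSup.mk'
    (by rintro ⟨x⟩ ⟨y⟩; exact sound (.A1 x y))
    (by rintro ⟨x⟩ ⟨y⟩ ⟨z⟩; exact sound (.A2 x y z))
    (by rintro ⟨x⟩; exact sound (.A3 x))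

/-- Deadlock is the least class. -/
instance : OrderBot (PCls α γ) where
  bot := mk γ .delta
  bot_le := by
    rintro ⟨x⟩
    exact sup_eq_right.1 (sound (.trans (.A1 _ _) (.A6 x)))

/-- The inaccessible process is the greatest class. -/
instance : OrderTop (PCls α γ) where
  top := mk γ .nex
  le_top := by
    rintro ⟨x⟩
    exact sup_eq_right.1 (sound (.NE1 x))

theorem mk_delta : mk γ (.delta : APT α Act) = ⊥ := rfl

/-- Sequential composition of classes. -/
def seq : PCls α γ → PCls α γ → PCls α γ :=
  Quotient.map₂ APT.seq fun _ _ h₁ _ _ h₂ => ADeriv.seqC h₁ h₂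

/-- Guarded command on classes. -/
def gc (φ : Fml α) : PCls α γ → PCls α γ :=
  Quotient.map (APT.gc φ) fun _ _ h => ADeriv.gcC (.refl φ) h

/-- The process that emits the signal `φ` and deadlocks. -/
def sig (φ : Fml α) : PCls α γ := mk γ (.se φ .delta)

/-- Left merge of classes. -/
def lm : PCls α γ → PCls α γ → PCls α γ :=
  Quotient.map₂ APT.lm fun _ _ h₁ _ _ h₂ => ADeriv.lmC h₁ h₂

/-- Communication merge of classes. -/
def cm : PCls α γ → PCls α γ → PCls α γ :=
  Quotient.map₂ APT.cm fun _ _ h₁ _ _ h₂ => ADeriv.cmC h₁ h₂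

/-- Parallel composition of classes. -/
def par : PCls α γ → PCls α γ → PCls α γ :=
  Quotient.map₂ APT.par fun _ _ h₁ _ _ h₂ => ADeriv.parC h₁ h₂

/-- Encapsulation on classes. -/
def encap (H : Set Act) : PCls α γ → PCls α γ :=
  Quotient.map (APT.encap H) fun _ _ h => ADeriv.encapC H h

/-- The class of an action or deadlock. -/
def act (a : Option Act) : PCls α γ := mk γ (actd a)

theorem act_none : (act none : PCls α γ) = ⊥ := rfl

/-! ### Signals -/

theorem mk_se (φ : Fml α) (p : APT α Act) : mk γ (.se φ p) = sig φ ⊔ mk γ p :=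
  (sound (.trans (.SE4 φ .delta p) (.seC (.refl φ) (.trans (.A1 _ _) (.A6 p))))).symm

theorem sig_congr {φ ψ : Fml α} (h : FEquiv φ ψ) : (sig φ : PCls α γ) = sig ψ :=
  sound (.seC (.of_fequiv h) (.refl _))

theorem sig_top : (sig Fml.top : PCls α γ) = ⊥ := sound (.SE1 _)

theorem sig_eq_top {φ : Fml α} (h : EqBot φ) : (sig φ : PCls α γ) = ⊤ :=
  (sig_congr (ψ := .bot) h).trans (sound (.SE2 _))

theorem sig_conj (φ ψ : Fml α) : (sig (φ.conj ψ) : PCls α γ) = sig φ ⊔ sig ψ := by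
  rw [sig, ← sound (.SE6 φ ψ .delta), mk_se, mk_se, mk_delta, sup_bot_eq]

/-! ### Guarded commands -/

theorem gc_congr {φ ψ : Fml α} (h : FEquiv φ ψ) (u : PCls α γ) : gc φ u = gc ψ u := by
  rcases u with ⟨x⟩
  exact sound (.gcC (.of_fequiv h) (.refl x))

theorem gc_top (u : PCls α γ) : gc Fml.top u = u := by
  rcases u with ⟨x⟩
  exact sound (.GC1 x)

theorem gc_eq_bot {φ : Fml α} (h : EqBot φ) (u : PCls α γ) : gc φ u = ⊥ := by
  rw [gc_congr (ψ := .bot) h]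
  rcases u with ⟨x⟩
  exact sound (.GC2 x)

theorem gc_bot (φ : Fml α) : gc φ (⊥ : PCls α γ) = ⊥ := sound (.GC3 φ)

theorem gc_sup (φ : Fml α) (u v : PCls α γ) : gc φ (u ⊔ v) = gc φ u ⊔ gc φ v := by
  rcases u with ⟨x⟩
  rcases v with ⟨y⟩
  exact sound (.GC4 φ x y)

theorem gc_gc (φ ψ : Fml α) (u : PCls α γ) : gc φ (gc ψ u) = gc (φ.conj ψ) u := by
  rcases u with ⟨x⟩
  exact sound (.GC6 φ ψ x)

theorem gc_disj (φ ψ : Fml α) (u : PCls α γ) : gc (φ.disj ψ) u = gc φ u ⊔ gc ψ u := by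
  rcases u with ⟨x⟩
  exact sound (.GC7 φ ψ x)

theorem gc_sig (φ ψ : Fml α) : gc φ (sig ψ : PCls α γ) = sig (φ.imp ψ) :=
  (sound (.SE8 φ ψ .delta)).trans (sound (.seC (.refl _) (.GC3 φ)))

theorem sig_sup_gc (φ : Fml α) (u : PCls α γ) : sig φ ⊔ gc φ u = sig φ ⊔ u := by
  rcases u with ⟨x⟩
  exact (mk_se φ (.gc φ x)).symm.trans ((sound (.SE7 φ x)).trans (mk_se φ x))

theorem gc_le_of_disj {φ ψ : Fml α} (h : FEquiv (φ.disj ψ) ψ) (u : PCls α γ) :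
    gc φ u ≤ gc ψ u := by
  rw [← gc_congr h, gc_disj]
  exact le_sup_left

theorem gc_le (φ : Fml α) (u : PCls α γ) : gc φ u ≤ u := by
  conv_rhs => rw [← gc_top u]
  refine gc_le_of_disj (fun σ => ?_) u
  simp only [eval, Fml.top]
  cases eval σ φ <;> rfl

/-! ### Sequential composition -/

theorem sup_seq (u v w : PCls α γ) : seq (u ⊔ v) w = seq u w ⊔ seq v w := by
  rcases u with ⟨x⟩
  rcases v with ⟨y⟩
  rcases w with ⟨z⟩
  exact sound (.A4 x y z)

theorem seq_assoc (u v w : PCls α γ) : seq (seq u v) w = seq u (seq v w) := by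
  rcases u with ⟨x⟩
  rcases v with ⟨y⟩
  rcases w with ⟨z⟩
  exact sound (.A5 x y z)

theorem bot_seq (u : PCls α γ) : seq ⊥ u = ⊥ := by
  rcases u with ⟨x⟩
  exact sound (.A7 x)

theorem act_seq_top (a : Option Act) : seq (act a) ⊤ = (⊥ : PCls α γ) := sound (.NE3 a)

theorem gc_seq (φ : Fml α) (u v : PCls α γ) : seq (gc φ u) v = gc φ (seq u v) := by
  rcases u with ⟨x⟩
  rcases v with ⟨y⟩
  exact (sound (.GC5 φ x y)).symm

theorem sig_seq (φ : Fml α) (u : PCls α γ) : seq (sig φ) u = sig φ := by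
  rcases u with ⟨x⟩
  exact sound (.trans (.SE5 φ .delta x) (.seC (.refl φ) (.A7 x)))

/-! ### Encapsulation -/

theorem encap_sup (H : Set Act) (u v : PCls α γ) : encap H (u ⊔ v) = encap H u ⊔ encap H v := by
  rcases u with ⟨x⟩
  rcases v with ⟨y⟩
  exact sound (.D3 H x y)

theorem encap_bot (H : Set Act) : encap H (⊥ : PCls α γ) = ⊥ := sound (.D1d H)

theorem encap_act_of_mem {H : Set Act} {a : Act} (h : a ∈ H) :
    encap H (act (some a) : PCls α γ) = ⊥ := sound (.D2 H a h)

theorem encap_act_of_notMem {H : Set Act} {a : Act} (h : a ∉ H) :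
    encap H (act (some a) : PCls α γ) = act (some a) := sound (.D1 H a h)

theorem encap_univ_act (a : Option Act) : encap Set.univ (act a : PCls α γ) = ⊥ := by
  cases a with
  | none => exact encap_bot _
  | some a => exact encap_act_of_mem (Set.mem_univ a)

theorem encap_seq (H : Set Act) (u v : PCls α γ) :
    encap H (seq u v) = seq (encap H u) (encap H v) := by
  rcases u with ⟨x⟩
  rcases v with ⟨y⟩
  exact sound (.D4 H x y)

theorem encap_gc (H : Set Act) (φ : Fml α) (u : PCls α γ) :
    encap H (gc φ u) = gc φ (encap H u) := by
  rcases u with ⟨x⟩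
  exact sound (.GC11 H φ x)

theorem encap_sig (H : Set Act) (φ : Fml α) : encap H (sig φ : PCls α γ) = sig φ :=
  sound (.trans (.SE12 H φ .delta) (.seC (.refl φ) (.D1d H)))

/-! ### Left merge -/

theorem sup_lm (u v w : PCls α γ) : lm (u ⊔ v) w = lm u w ⊔ lm v w := by
  rcases u with ⟨x⟩
  rcases v with ⟨y⟩
  rcases w with ⟨z⟩
  exact sound (.CM4 x y z)

theorem act_lm (a : Option Act) (u : PCls α γ) :
    lm (act a) u = seq (act a) u ⊔ encap Set.univ u := by
  rcases u with ⟨x⟩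
  exact sound (.CM2S a x)

theorem act_seq_lm (a : Option Act) (u v : PCls α γ) :
    lm (seq (act a) u) v = seq (act a) (par u v) ⊔ encap Set.univ v := by
  rcases u with ⟨x⟩
  rcases v with ⟨y⟩
  exact sound (.CM3S a x y)

theorem gc_lm (φ : Fml α) (u v : PCls α γ) :
    lm (gc φ u) v = gc φ (lm u v) ⊔ encap Set.univ v := by
  rcases u with ⟨x⟩
  rcases v with ⟨y⟩
  exact sound (.GC8S φ x y)

theorem sig_lm (φ : Fml α) (u : PCls α γ) : lm (sig φ) u = sig φ ⊔ encap Set.univ u := by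
  have h : lm ⊥ u = encap Set.univ u := by
    rw [← act_none, act_lm, act_none, bot_seq, bot_sup_eq]
  rw [← h]
  rcases u with ⟨x⟩
  exact (sound (.SE9 φ .delta x)).trans (mk_se φ (.lm .delta x))

/-! ### Communication merge -/

theorem sup_cm (u v w : PCls α γ) : cm (u ⊔ v) w = cm u w ⊔ cm v w := by
  rcases u with ⟨x⟩
  rcases v with ⟨y⟩
  rcases w with ⟨z⟩
  exact sound (.CM8 x y z)

theorem cm_sup (u v w : PCls α γ) : cm u (v ⊔ w) = cm u v ⊔ cm u w := by
  rcases u with ⟨x⟩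
  rcases v with ⟨y⟩
  rcases w with ⟨z⟩
  exact sound (.CM9 x y z)

theorem gc_cm (φ : Fml α) (u v : PCls α γ) :
    cm (gc φ u) v = gc φ (cm u v) ⊔ encap Set.univ v := by
  rcases u with ⟨x⟩
  rcases v with ⟨y⟩
  exact sound (.GC9S φ x y)

theorem cm_gc (φ : Fml α) (u v : PCls α γ) :
    cm u (gc φ v) = gc φ (cm u v) ⊔ encap Set.univ u := by
  rcases u with ⟨x⟩
  rcases v with ⟨y⟩
  exact sound (.GC10S φ x y)

theorem sig_cm (φ : Fml α) (u : PCls α γ) : cm (sig φ) u = sig φ ⊔ cm ⊥ u := by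
  rcases u with ⟨x⟩
  exact (sound (.SE10 φ .delta x)).trans (mk_se φ (.cm .delta x))

theorem cm_sig (φ : Fml α) (u : PCls α γ) : cm u (sig φ) = sig φ ⊔ cm u ⊥ := by
  rcases u with ⟨x⟩
  exact (sound (.SE11 φ x .delta)).trans (mk_se φ (.cm x .delta))

theorem act_cm_act (a b : Option Act) : cm (act a) (act b) = (act (γ a b) : PCls α γ) :=
  sound (.CF a b)

theorem act_seq_cm_act (a b : Option Act) (u : PCls α γ) :
    cm (seq (act a) u) (act b) = seq (act (γ a b)) u := by
  rcases u with ⟨x⟩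
  exact sound (.CM5 a b x)

theorem act_cm_act_seq (a b : Option Act) (u : PCls α γ) :
    cm (act a) (seq (act b) u) = seq (act (γ a b)) u := by
  rcases u with ⟨x⟩
  exact sound (.CM6 a b x)

theorem act_seq_cm_act_seq (a b : Option Act) (u v : PCls α γ) :
    cm (seq (act a) u) (seq (act b) v) = seq (act (γ a b)) (par u v) := by
  rcases u with ⟨x⟩
  rcases v with ⟨y⟩
  exact sound (.CM7 a b x y)

theorem par_eq (u v : PCls α γ) : par u v = lm u v ⊔ lm v u ⊔ cm u v := by
  rcases u with ⟨x⟩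
  rcases v with ⟨y⟩
  exact sound (.CM1 x y)

/-- Join-preserving maps are monotone. -/
theorem monotone_of_sup {f : PCls α γ → PCls α γ} (hf : ∀ u v, f (u ⊔ v) = f u ⊔ f v) :
    Monotone f := fun u v h => by
  rw [← sup_eq_right.2 h, hf]
  exact le_sup_left

theorem gc_mono (φ : Fml α) : Monotone (gc φ : PCls α γ → PCls α γ) :=
  monotone_of_sup (gc_sup φ)

theorem seq_mono_left (w : PCls α γ) : Monotone fun u => seq u w :=
  monotone_of_sup fun u v => sup_seq u v w

theorem encap_mono (H : Set Act) : Monotone (encap H : PCls α γ → PCls α γ) :=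
  monotone_of_sup (encap_sup H)

theorem lm_mono_left (w : PCls α γ) : Monotone fun u => lm u w :=
  monotone_of_sup fun u v => sup_lm u v w

theorem cm_mono {u u' v v' : PCls α γ} (h : u ≤ u') (h' : v ≤ v') : cm u v ≤ cm u' v' :=
  (monotone_of_sup (fun a b => sup_cm a b v) h).trans (monotone_of_sup (cm_sup u') h')

theorem lm_le_par (u v : PCls α γ) : lm u v ≤ par u v := by
  rw [par_eq]
  exact le_sup_left.trans le_sup_left

theorem lm_le_par_swap (u v : PCls α γ) : lm v u ≤ par u v := by
  rw [par_eq]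
  exact le_sup_right.trans le_sup_left

theorem cm_le_par (u v : PCls α γ) : cm u v ≤ par u v := by
  rw [par_eq]
  exact le_sup_right

end PCls

theorem fequiv_conj_comm {α : Type} (φ ψ : Fml α) : FEquiv (φ.conj ψ) (ψ.conj φ) := fun σ => by
  simp only [eval]
  cases eval σ φ <;> cases eval σ ψ <;> rfl

namespace APT

variable {α Act : Type}

/-- An upper bound on the number of consecutive steps of a process term. -/
def depth : APT α Act → ℕ
  | .act _ => 1
  | .delta => 0
  | .nex => 0
  | .alt p q => max p.depth q.depth
  | .seq p q => p.depth + q.depth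
  | .gc _ p => p.depth
  | .se _ p => p.depth
  | .par p q => p.depth + q.depth
  | .lm p q => p.depth + q.depth
  | .cm p q => p.depth + q.depth
  | .encap _ p => p.depth

/-- The depth of a transition target, with √ counted as zero. -/
def targetDepth : Option (APT α Act) → ℕ
  | none => 0
  | some p => p.depth

theorem depth_lt_of_tr {γ : Option Act → Option Act → Option Act} {p : APT α Act} {φ : Fml α}
    {a : Act} {o : Option (APT α Act)} (h : ATr γ p φ a o) : targetDepth o < p.depth := by
  induction h with
  | @encapR x φ a o H h hH ih => cases o <;> exact ih
  | _ => simp only [targetDepth, depth] at *; omega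

/-- Parallel composition of transition targets, with √ as neutral element. -/
def parTarget : Option (APT α Act) → Option (APT α Act) → Option (APT α Act)
  | none, o => o
  | some x, none => some x
  | some x, some y => some (.par x y)

/-- A transition target that is √ or whose signal is not equivalent to ⊥. -/
def Accessible : Option (APT α Act) → Prop
  | none => True
  | some p => ¬ EqBot (sigA p)

end APT

open APT

namespace ATr

variable {α Act : Type} {γ : Option Act → Option Act → Option Act} {x y : APT α Act}
  {φ ψ : Fml α} {a b c : Act} {o o' : Option (APT α Act)}

theorem lm_of_left (h : ATr γ x φ a o) (hs : ¬ EqBot (sigA (.lm x y : APT α Act)))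
    (ho : Accessible (parTarget o (some y))) : ATr γ (.lm x y) φ a (parTarget o (some y)) := by
  cases o with
  | none => exact .lmT y h hs ho
  | some x' => exact .lmS y h hs ho

theorem par_of_left (h : ATr γ x φ a o) (hs : ¬ EqBot (sigA (.par x y : APT α Act)))
    (ho : Accessible (parTarget o (some y))) : ATr γ (.par x y) φ a (parTarget o (some y)) := by
  cases o with
  | none => exact .parTL y h hs ho
  | some x' => exact .parSL y h hs ho

theorem par_of_right (h : ATr γ y φ a o) (hs : ¬ EqBot (sigA (.par x y : APT α Act)))
    (ho : Accessible (parTarget (some x) o)) : ATr γ (.par x y) φ a (parTarget (some x) o) := by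
  cases o with
  | none => exact .parTR x h hs ho
  | some y' => exact .parSR x h hs ho

theorem cm_of_both (hx : ATr γ x φ a o) (hy : ATr γ y ψ b o') (hc : γ (some a) (some b) = some c)
    (hφ : ¬ EqBot (φ.conj ψ)) (hs : ¬ EqBot (sigA (.cm x y : APT α Act)))
    (ho : Accessible (parTarget o o')) : ATr γ (.cm x y) (φ.conj ψ) c (parTarget o o') := by
  cases o <;> cases o'
  · exact .cmTT hx hy hc hφ hs
  · exact .cmTS hx hy hc hφ hs
  · exact .cmST hx hy hc hφ hs
  · exact .cmSS hx hy hc hφ hs ho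

theorem par_of_both (hx : ATr γ x φ a o) (hy : ATr γ y ψ b o') (hc : γ (some a) (some b) = some c)
    (hφ : ¬ EqBot (φ.conj ψ)) (hs : ¬ EqBot (sigA (.par x y : APT α Act)))
    (ho : Accessible (parTarget o o')) : ATr γ (.par x y) (φ.conj ψ) c (parTarget o o') := by
  cases o <;> cases o'
  · exact .parCTT hx hy hc hφ hs
  · exact .parCTS hx hy hc hφ hs
  · exact .parCST hx hy hc hφ hs
  · exact .parCSS hx hy hc hφ hs ho

end ATr

namespace PCls

variable {α Act : Type} {γ : Option Act → Option Act → Option Act}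

/-- An action or deadlock followed by a transition target. -/
def step (γ : Option Act → Option Act → Option Act) (a : Option Act) :
    Option (APT α Act) → PCls α γ
  | none => act a
  | some p => seq (act a) (mk γ p)

/-- The summand that corresponds to a transition. -/
def tr (γ : Option Act → Option Act → Option Act) (φ : Fml α) (a : Act)
    (o : Option (APT α Act)) : PCls α γ :=
  gc φ (step γ (some a) o)

/-- A process term dominates its root signal. -/
theorem sig_le_mk (p : APT α Act) : sig (sigA p) ≤ mk γ p := by
  have le_lm : ∀ {x y : APT α Act}, sig (sigA x) ≤ mk γ x → sig (sigA y) ≤ mk γ y →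
      sig (sigA x) ⊔ sig (sigA y) ≤ lm (mk γ x) (mk γ y) := fun {x y} hx hy => by
    refine le_trans ?_ (lm_mono_left _ hx)
    change _ ≤ lm _ _
    rw [sig_lm]
    refine sup_le_sup_left ?_ _
    rw [← encap_sig Set.univ]
    exact encap_mono _ hy
  induction p with
  | act a => exact sig_top.trans_le bot_le
  | delta => exact sig_top.trans_le bot_le
  | nex => exact le_top
  | alt x y hx hy => exact (sig_conj _ _).trans_le (sup_le_sup hx hy)
  | seq x y hx _ => exact (sig_seq (sigA x) (mk γ y)).symm.trans_le (seq_mono_left _ hx)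
  | gc φ x hx => exact (gc_sig φ (sigA x)).symm.trans_le (gc_mono φ hx)
  | se φ x hx =>
    rw [mk_se]
    exact (sig_conj _ _).trans_le (sup_le_sup_left hx _)
  | par x y hx hy => exact ((sig_conj _ _).trans_le (le_lm hx hy)).trans (lm_le_par _ _)
  | lm x y hx hy => exact (sig_conj _ _).trans_le (le_lm hx hy)
  | cm x y hx hy =>
    refine le_trans ?_ (cm_mono hx hy)
    change sig ((sigA x).conj (sigA y)) ≤ _
    rw [sig_conj]
    refine sup_le ?_ ?_
    · rw [sig_cm]
      exact le_sup_left
    · rw [cm_sig]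
      exact le_sup_left
  | encap H x hx => exact (encap_sig H (sigA x)).symm.trans_le (encap_mono H hx)

theorem mk_eq_top {p : APT α Act} (h : EqBot (sigA p)) : mk γ p = ⊤ :=
  top_le_iff.1 ((sig_eq_top h).symm.trans_le (sig_le_mk p))

theorem step_none (o : Option (APT α Act)) : step γ none o = ⊥ := by
  cases o with
  | none => rfl
  | some p => exact bot_seq _

theorem step_eq_bot {o : Option (APT α Act)} (h : ¬ Accessible o) (a : Option Act) :
    step γ a o = ⊥ := by
  cases o with
  | none => exact absurd trivial h
  | some p => rw [step, mk_eq_top (not_not.1 h), act_seq_top]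

theorem encap_univ_step (a : Option Act) (o : Option (APT α Act)) :
    encap Set.univ (step γ a o) = ⊥ := by
  cases o with
  | none => exact encap_univ_act a
  | some p => rw [step, encap_seq, encap_univ_act, bot_seq]

theorem encap_step_of_notMem {H : Set Act} {a : Act} (h : a ∉ H) (o : Option (APT α Act)) :
    encap H (step γ (some a) o) = step γ (some a) (o.map (APT.encap H)) := by
  cases o with
  | none => exact encap_act_of_notMem h
  | some p =>
    rw [step, encap_seq, encap_act_of_notMem h]
    rfl

theorem encap_univ_tr (φ : Fml α) (a : Act) (o : Option (APT α Act)) :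
    encap Set.univ (tr γ φ a o) = ⊥ := by
  rw [tr, encap_gc, encap_univ_step, gc_bot]

theorem step_cm_step (a b : Option Act) (o o' : Option (APT α Act)) :
    cm (step γ a o) (step γ b o') = step γ (γ a b) (parTarget o o') := by
  cases o <;> cases o'
  · exact act_cm_act a b
  · exact act_cm_act_seq a b _
  · exact act_seq_cm_act a b _
  · exact act_seq_cm_act_seq a b _ _

theorem tr_cm_tr (φ ψ : Fml α) (a b : Act) (o o' : Option (APT α Act)) :
    cm (tr γ φ a o) (tr γ ψ b o') =
      gc (φ.conj ψ) (step γ (γ (some a) (some b)) (parTarget o o')) := by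
  rw [tr, gc_cm, encap_univ_tr, sup_bot_eq, tr, cm_gc, encap_univ_step, sup_bot_eq, step_cm_step,
    gc_gc]

theorem tr_lm (φ : Fml α) (a : Act) (o : Option (APT α Act)) (y : APT α Act) :
    lm (tr γ φ a o) (mk γ y) =
      tr γ φ a (parTarget o (some y)) ⊔ encap Set.univ (mk γ y) := by
  have h : lm (step γ (some a) o) (mk γ y) =
      step γ (some a) (parTarget o (some y)) ⊔ encap Set.univ (mk γ y) := by
    cases o with
    | none => exact act_lm _ _
    | some x => exact act_seq_lm _ _ _
  rw [tr, gc_lm, h, gc_sup, sup_assoc, sup_eq_right.2 (gc_le φ (encap Set.univ (mk γ y))), tr]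

theorem bot_cm_tr (hγ : ∀ a, γ none a = none) (φ : Fml α) (a : Act) (o : Option (APT α Act)) :
    cm ⊥ (tr γ φ a o) = ⊥ := by
  have h : cm ⊥ (step γ (some a) o) = ⊥ := by
    rw [← step_none none, step_cm_step, hγ, step_none, step_none]
  rw [tr, cm_gc, h, gc_bot, encap_bot, sup_bot_eq]

theorem tr_cm_bot (hγ : ∀ a, γ a none = none) (φ : Fml α) (a : Act) (o : Option (APT α Act)) :
    cm (tr γ φ a o) ⊥ = ⊥ := by
  have h : cm (step γ (some a) o) ⊥ = ⊥ := by
    rw [← step_none none, step_cm_step, hγ, step_none, step_none]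
  rw [tr, gc_cm, h, gc_bot, encap_bot, sup_bot_eq]

theorem bot_cm_bot (hγ : ∀ a, γ none a = none) : cm ⊥ ⊥ = (⊥ : PCls α γ) := by
  rw [← act_none, act_cm_act, hγ]

/-- The classes below finite joins of the root signal and the transition summands of `p`. -/
inductive Below (γ : Option Act → Option Act → Option Act) (p : APT α Act) : PCls α γ → Prop
  | sig : Below γ p (sig (sigA p))
  | tr {φ : Fml α} {a : Act} {o : Option (APT α Act)} : ATr γ p φ a o → Below γ p (tr γ φ a o)
  | sup {u v : PCls α γ} : Below γ p u → Below γ p v → Below γ p (u ⊔ v)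
  | le {u v : PCls α γ} : u ≤ v → Below γ p v → Below γ p u

/-- The classes described by `Below` as an ideal. -/
def belowIdeal (γ : Option Act → Option Act → Option Act) (p : APT α Act) :
    Order.Ideal (PCls α γ) where
  carrier := {u | Below γ p u}
  lower' := fun _ _ h hu => .le h hu
  nonempty' := ⟨_, .sig⟩
  directed' := fun u hu v hv => ⟨u ⊔ v, .sup hu hv, le_sup_left, le_sup_right⟩

theorem Below.map_mem {p : APT α Act} {u : PCls α γ} (h : Below γ p u) {f : PCls α γ → PCls α γ}
    (hf : ∀ u v, f (u ⊔ v) = f u ⊔ f v) {J : Order.Ideal (PCls α γ)}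
    (hs : f (PCls.sig (sigA p)) ∈ J)
    (ht : ∀ φ a o, ATr γ p φ a o → f (PCls.tr γ φ a o) ∈ J) : f u ∈ J := by
  induction h with
  | sig => exact hs
  | tr h => exact ht _ _ _ h
  | sup _ _ h₁ h₂ =>
    rw [hf]
    exact Order.Ideal.sup_mem h₁ h₂
  | le h _ ih => exact J.lower (monotone_of_sup hf h) ih

theorem encap_univ_le {y : APT α Act} (hy : Below γ y (mk γ y)) :
    encap Set.univ (mk γ y) ≤ sig (sigA y) :=
  Order.Ideal.mem_principal.1 <| hy.map_mem (J := .principal (sig (sigA y))) (encap_sup Set.univ)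
    (Order.Ideal.mem_principal.2 (encap_sig _ _).le)
    (fun φ a o _ => Order.Ideal.mem_principal.2 ((encap_univ_tr φ a o).trans_le bot_le))

theorem lm_mem {x y : APT α Act} (hx : Below γ x (mk γ x)) (hy : Below γ y (mk γ y))
    {J : Order.Ideal (PCls α γ)} (hsx : sig (sigA x) ∈ J) (hsy : sig (sigA y) ∈ J)
    (ht : ∀ φ a o, ATr γ x φ a o → Accessible (parTarget o (some y)) →
      tr γ φ a (parTarget o (some y)) ∈ J) :
    lm (mk γ x) (mk γ y) ∈ J := by
  have hy := J.lower (encap_univ_le hy) hsy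
  refine hx.map_mem (f := fun u => lm u (mk γ y)) (fun u v => sup_lm u v _) ?_
    fun φ a o h => ?_
  · rw [sig_lm]
    exact Order.Ideal.sup_mem hsx hy
  · rw [tr_lm]
    refine Order.Ideal.sup_mem ?_ hy
    by_cases ho : Accessible (parTarget o (some y))
    · exact ht φ a o h ho
    · rw [tr, step_eq_bot ho, gc_bot]
      exact J.bot_mem

theorem cm_mem (hγcomm : ∀ a b, γ a b = γ b a) (hγ : ∀ a, γ none a = none) {x y : APT α Act}
    (hx : Below γ x (mk γ x)) (hy : Below γ y (mk γ y))
    {J : Order.Ideal (PCls α γ)} (hsx : sig (sigA x) ∈ J) (hsy : sig (sigA y) ∈ J)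
    (ht : ∀ φ a o ψ b o' c, ATr γ x φ a o → ATr γ y ψ b o' → γ (some a) (some b) = some c →
      ¬ EqBot (φ.conj ψ) → Accessible (parTarget o o') →
      tr γ (φ.conj ψ) c (parTarget o o') ∈ J) :
    cm (mk γ x) (mk γ y) ∈ J := by
  have hγ' : ∀ a, γ a none = none := fun a => (hγcomm _ _).trans (hγ a)
  refine hx.map_mem (f := fun u => cm u (mk γ y)) (fun u v => sup_cm u v _) ?_
    fun φ a o h => ?_
  · refine hy.map_mem (cm_sup _) ?_ fun ψ b o' _ => ?_
    · rw [sig_cm, cm_sig, bot_cm_bot hγ, sup_bot_eq]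
      exact Order.Ideal.sup_mem hsx hsy
    · rw [sig_cm, bot_cm_tr hγ, sup_bot_eq]
      exact hsx
  · refine hy.map_mem (cm_sup _) ?_ fun ψ b o' h' => ?_
    · rw [cm_sig, tr_cm_bot hγ', sup_bot_eq]
      exact hsy
    · rw [tr_cm_tr]
      rcases hc : γ (some a) (some b) with _ | c
      · rw [step_none, gc_bot]
        exact J.bot_mem
      by_cases hφ : EqBot (φ.conj ψ)
      · rw [gc_eq_bot hφ]
        exact J.bot_mem
      by_cases ho : Accessible (parTarget o o')
      · exact ht φ a o ψ b o' c h h' hc hφ ho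
      · rw [step_eq_bot ho, gc_bot]
        exact J.bot_mem

theorem step_parTarget_swap {o o' : Option (APT α Act)} (a : Option Act)
    (h : ∀ x y, o = some x → o' = some y → par (mk γ x) (mk γ y) = par (mk γ y) (mk γ x)) :
    step γ a (parTarget o o') = step γ a (parTarget o' o) := by
  cases o <;> cases o' <;> try rfl
  exact congrArg (seq (act a)) (h _ _ rfl rfl)

/-- Parallel composition commutes on process terms of total depth less than `n`. -/
def ParCommBelow (α : Type) (γ : Option Act → Option Act → Option Act) (n : ℕ) : Prop :=
  ∀ x y : APT α Act, x.depth + y.depth < n → par (mk γ x) (mk γ y) = par (mk γ y) (mk γ x)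

/-- Every process term is below the join of its root signal and finitely many of its
transition summands. -/
theorem below_mk (hγcomm : ∀ a b, γ a b = γ b a) (hγ : ∀ a, γ none a = none) {n : ℕ}
    (hn : ParCommBelow α γ n) (p : APT α Act) (hp : p.depth ≤ n) : Below γ p (mk γ p) := by
  have sig_left : ∀ φ ψ : Fml α, (sig φ : PCls α γ) ≤ sig (φ.conj ψ) := fun φ ψ => by
    rw [sig_conj]
    exact le_sup_left
  have sig_right : ∀ φ ψ : Fml α, (sig ψ : PCls α γ) ≤ sig (φ.conj ψ) := fun φ ψ => by
    rw [sig_conj]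
    exact le_sup_right
  have of_eqBot : ∀ q : APT α Act, EqBot (sigA q) → Below γ q (mk γ q) := fun q hq =>
    .le ((sig_eq_top hq).symm ▸ le_top) .sig
  induction p with
  | act a => exact .le (gc_top (act (some a))).symm.le (.tr (.act a))
  | delta => exact .le bot_le .sig
  | nex => exact of_eqBot _ fun _ => rfl
  | alt x y hx hy =>
    simp only [depth, max_le_iff] at hp
    by_cases hs : EqBot (sigA (.alt x y))
    · exact of_eqBot _ hs
    refine .sup (u := mk γ x) (v := mk γ y) ?_ ?_
    · exact (hx hp.1).map_mem (f := id) (J := belowIdeal γ (.alt x y)) (fun _ _ => rfl)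
        (.le (sig_left _ _) .sig) fun _ _ _ h => .tr (.altL y h hs)
    · exact (hy hp.2).map_mem (f := id) (J := belowIdeal γ (.alt x y)) (fun _ _ => rfl)
        (.le (sig_right _ _) .sig) fun _ _ _ h => .tr (.altR x h hs)
  | seq x y hx _ =>
    simp only [depth] at hp
    refine (hx (by omega)).map_mem (f := fun u => seq u (mk γ y))
      (J := belowIdeal γ (.seq x y)) (fun u v => sup_seq u v _) ?_ fun φ a o h => ?_
    · rw [sig_seq]
      exact .sig
    · rw [tr, gc_seq]
      cases o with
      | none =>
        by_cases hs : EqBot (sigA y)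
        · rw [mk_eq_top hs, step, act_seq_top, gc_bot]
          exact Order.Ideal.bot_mem _
        · exact .tr (.seqT y h hs)
      | some x' =>
        rw [step, seq_assoc]
        exact .tr (.seqS y h)
  | gc ψ x hx =>
    refine (hx hp).map_mem (J := belowIdeal γ (.gc ψ x)) (gc_sup ψ) ?_ fun φ a o h => ?_
    · rw [gc_sig]
      exact .sig
    · rw [tr, gc_gc, gc_congr (fequiv_conj_comm ψ φ)]
      by_cases hs : EqBot (φ.conj ψ)
      · rw [gc_eq_bot hs]
        exact Order.Ideal.bot_mem _
      · exact .tr (.gcR ψ h hs)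
  | se ψ x hx =>
    by_cases hs : EqBot (sigA (.se ψ x))
    · exact of_eqBot _ hs
    rw [mk_se]
    refine .sup (.le (sig_left _ _) .sig) ?_
    exact (hx hp).map_mem (f := id) (J := belowIdeal γ (.se ψ x)) (fun _ _ => rfl)
      (.le (sig_right _ _) .sig) fun _ _ _ h => .tr (.seR ψ h hs)
  | par x y hx hy =>
    simp only [depth] at hp
    by_cases hs : EqBot (sigA (.par x y))
    · exact of_eqBot _ hs
    have hx := hx (by omega)
    have hy := hy (by omega)
    have hsx : sig (sigA x) ∈ belowIdeal γ (.par x y) := .le (sig_left _ _) .sig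
    have hsy : sig (sigA y) ∈ belowIdeal γ (.par x y) := .le (sig_right _ _) .sig
    refine .le (par_eq (mk γ x) (mk γ y)).le (.sup (.sup ?_ ?_) ?_)
    · exact lm_mem hx hy hsx hsy fun φ a o h ho => .tr (h.par_of_left hs ho)
    · refine lm_mem hy hx hsy hsx fun φ a o h ho => ?_
      have hd := depth_lt_of_tr h
      rw [tr, step_parTarget_swap (some a) (fun y' x' hy' hx' => hn y' x' (by
        cases hx'
        subst hy'
        simp only [targetDepth] at hd
        omega))]
      refine .tr (h.par_of_right hs ?_)
      cases o with
      | none => exact ho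
      | some y' => exact fun he => ho fun σ => (fequiv_conj_comm _ _ σ).trans (he σ)
    · exact cm_mem hγcomm hγ hx hy hsx hsy fun φ a o ψ b o' c h h' hc hφ ho =>
        .tr (h.par_of_both h' hc hφ hs ho)
  | lm x y hx hy =>
    simp only [depth] at hp
    by_cases hs : EqBot (sigA (.lm x y))
    · exact of_eqBot _ hs
    exact lm_mem (J := belowIdeal γ (.lm x y)) (hx (by omega)) (hy (by omega))
      (.le (sig_left _ _) .sig) (.le (sig_right _ _) .sig)
      fun φ a o h ho => .tr (h.lm_of_left hs ho)
  | cm x y hx hy =>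
    simp only [depth] at hp
    by_cases hs : EqBot (sigA (.cm x y))
    · exact of_eqBot _ hs
    exact cm_mem (J := belowIdeal γ (.cm x y)) hγcomm hγ (hx (by omega)) (hy (by omega))
      (.le (sig_left _ _) .sig) (.le (sig_right _ _) .sig)
      fun φ a o ψ b o' c h h' hc hφ ho => .tr (h.cm_of_both h' hc hφ hs ho)
  | encap H x hx =>
    refine (hx hp).map_mem (J := belowIdeal γ (.encap H x)) (encap_sup H) ?_ fun φ a o h => ?_
    · rw [encap_sig]
      exact .sig
    · rw [tr, encap_gc]
      by_cases ha : a ∈ H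
      · cases o with
        | none =>
          rw [step, encap_act_of_mem ha, gc_bot]
          exact Order.Ideal.bot_mem _
        | some x' =>
          rw [step, encap_seq, encap_act_of_mem ha, bot_seq, gc_bot]
          exact Order.Ideal.bot_mem _
      · rw [encap_step_of_notMem ha]
        exact .tr (.encapR H h ha)

theorem tr_le_lm {x y : APT α Act} {φ : Fml α} {a : Act} {o : Option (APT α Act)}
    (h : tr γ φ a o ≤ mk γ x) :
    tr γ φ a (parTarget o (some y)) ≤ lm (mk γ x) (mk γ y) := by
  refine le_trans ?_ (lm_mono_left _ h)
  change _ ≤ lm (tr γ φ a o) _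
  rw [tr_lm]
  exact le_sup_left

theorem tr_le_cm {x y : APT α Act} {φ ψ : Fml α} {a b c : Act} {o o' : Option (APT α Act)}
    (h : tr γ φ a o ≤ mk γ x) (h' : tr γ ψ b o' ≤ mk γ y) (hc : γ (some a) (some b) = some c) :
    tr γ (φ.conj ψ) c (parTarget o o') ≤ cm (mk γ x) (mk γ y) := by
  refine le_trans ?_ (cm_mono h h')
  rw [tr_cm_tr, hc, tr]

/-- A process term dominates its transition summands. -/
theorem tr_le_mk {n : ℕ} (hn : ParCommBelow α γ n) {p : APT α Act} {φ : Fml α} {a : Act}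
    {o : Option (APT α Act)} (h : ATr γ p φ a o) (hp : p.depth ≤ n) : tr γ φ a o ≤ mk γ p := by
  induction h with
  | act a => exact (gc_top _).le
  | altL y _ _ ih => exact (ih ((le_max_left _ _).trans hp)).trans (le_sup_left (b := mk γ y))
  | altR x _ _ ih => exact (ih ((le_max_right _ _).trans hp)).trans (le_sup_right (a := mk γ x))
  | seqT y _ _ ih =>
    simp only [depth] at hp
    exact (gc_seq _ _ _).symm.trans_le (seq_mono_left (mk γ y) (ih (by omega)))
  | @seqS x φ a x' y _ ih =>
    simp only [depth] at hp
    refine le_trans ?_ (seq_mono_left (mk γ y) (ih (by omega)))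
    change _ ≤ seq (gc φ (seq (act (some a)) (mk γ x'))) (mk γ y)
    rw [gc_seq, seq_assoc]
    exact le_rfl
  | @gcR x φ a o ψ _ _ ih =>
    refine le_trans ?_ (gc_mono ψ (ih hp))
    rw [tr, gc_congr (fequiv_conj_comm φ ψ), ← gc_gc]
    exact le_rfl
  | seR ψ _ _ ih =>
    rw [mk_se]
    exact (ih hp).trans le_sup_right
  | parTL y _ _ _ ih =>
    simp only [depth] at hp
    exact (tr_le_lm (ih (by omega))).trans (lm_le_par _ _)
  | parTR x _ _ _ ih =>
    simp only [depth] at hp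
    exact (tr_le_lm (ih (by omega))).trans (lm_le_par_swap _ _)
  | parSL y _ _ _ ih =>
    simp only [depth] at hp
    exact (tr_le_lm (ih (by omega))).trans (lm_le_par _ _)
  | @parSR x y φ a y' h _ _ ih =>
    simp only [depth] at hp
    have hd := depth_lt_of_tr h
    simp only [targetDepth] at hd
    refine le_trans (le_of_eq ?_)
      ((tr_le_lm (y := x) (ih (by omega))).trans (lm_le_par_swap (mk γ x) (mk γ y)))
    exact congrArg (fun u => gc φ (seq (act (some a)) u)) (hn x y' (by omega))
  | parCTT _ _ hc _ _ ih ih' =>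
    simp only [depth] at hp
    exact (tr_le_cm (ih (by omega)) (ih' (by omega)) hc).trans (cm_le_par _ _)
  | parCTS _ _ hc _ _ ih ih' =>
    simp only [depth] at hp
    exact (tr_le_cm (ih (by omega)) (ih' (by omega)) hc).trans (cm_le_par _ _)
  | parCST _ _ hc _ _ ih ih' =>
    simp only [depth] at hp
    exact (tr_le_cm (ih (by omega)) (ih' (by omega)) hc).trans (cm_le_par _ _)
  | parCSS _ _ hc _ _ _ ih ih' =>
    simp only [depth] at hp
    exact (tr_le_cm (ih (by omega)) (ih' (by omega)) hc).trans (cm_le_par _ _)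
  | lmT y _ _ _ ih =>
    simp only [depth] at hp
    exact tr_le_lm (ih (by omega))
  | lmS y _ _ _ ih =>
    simp only [depth] at hp
    exact tr_le_lm (ih (by omega))
  | cmTT _ _ hc _ _ ih ih' =>
    simp only [depth] at hp
    exact tr_le_cm (ih (by omega)) (ih' (by omega)) hc
  | cmTS _ _ hc _ _ ih ih' =>
    simp only [depth] at hp
    exact tr_le_cm (ih (by omega)) (ih' (by omega)) hc
  | cmST _ _ hc _ _ ih ih' =>
    simp only [depth] at hp
    exact tr_le_cm (ih (by omega)) (ih' (by omega)) hc
  | cmSS _ _ hc _ _ _ ih ih' =>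
    simp only [depth] at hp
    exact tr_le_cm (ih (by omega)) (ih' (by omega)) hc
  | @encapR x φ a o H _ ha ih =>
    refine le_trans (le_of_eq ?_) (encap_mono H (ih hp))
    rw [tr, tr, encap_gc, encap_step_of_notMem ha]

/-- Parallel composition of closed process terms is derivably commutative. -/
theorem parCommBelow (hγcomm : ∀ a b, γ a b = γ b a) (hγ : ∀ a, γ none a = none) (n : ℕ) :
    ParCommBelow α γ n := by
  induction n with
  | zero => exact fun _ _ h => absurd h (Nat.not_lt_zero _)
  | succ n hn =>
    have key : ∀ x y : APT α Act, x.depth + y.depth ≤ n →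
        cm (mk γ x) (mk γ y) ≤ cm (mk γ y) (mk γ x) := by
      intro x y h
      have hs : sig (sigA y) ⊔ sig (sigA x) ≤ cm (mk γ y) (mk γ x) :=
        (sig_conj _ _).symm.trans_le (sig_le_mk (.cm y x))
      refine Order.Ideal.mem_principal.1 <| cm_mem hγcomm hγ
        (below_mk hγcomm hγ hn x (by omega)) (below_mk hγcomm hγ hn y (by omega))
        (J := .principal (cm (mk γ y) (mk γ x)))
        (le_sup_right.trans hs) (le_sup_left.trans hs) fun φ a o ψ b o' c hx hy hc hφ ho => ?_
      have hdx := depth_lt_of_tr hx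
      have hdy := depth_lt_of_tr hy
      have hle := tr_le_cm (tr_le_mk hn hy (by omega)) (tr_le_mk hn hx (by omega))
        ((hγcomm _ _).trans hc)
      rw [tr, gc_congr (fequiv_conj_comm ψ φ), step_parTarget_swap (some c) (fun y' x' hy' hx' =>
        hn y' x' (by
          subst hx' hy'
          simp only [targetDepth] at hdx hdy
          omega))] at hle
      exact Order.Ideal.mem_principal.2 hle
    intro x y h
    rw [par_eq, par_eq, sup_comm (lm (mk γ x) (mk γ y)),
      le_antisymm (key x y (by omega)) (key y x (by omega))]

/-- A guard may be split along valuations, relative to an emitted signal. -/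
theorem gc_le_of_forall_val [Finite α] {φ s : Fml α} {u v : PCls α γ} (hs : sig s ≤ v)
    (h : ∀ σ, eval σ s ≠ .f → eval σ φ ≠ .f → ∃ ψ, eval σ ψ = eval σ φ ∧ gc ψ u ≤ v) :
    gc φ u ≤ v := by
  have hfin : Finite V3 := Finite.of_surjective (fun i : Fin 3 => ![V3.t, V3.f, V3.b] i) (by
    rintro (_ | _ | _)
    exacts [⟨0, rfl⟩, ⟨1, rfl⟩, ⟨2, rfl⟩])
  have hcover : ∀ F : Finset (α → V3), ∃ ψ, gc ψ u ≤ v ∧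
      ∀ σ ∈ F, disjT (eval σ (s.conj φ)) (eval σ ψ) = eval σ ψ := by
    classical
    intro F
    induction F using Finset.induction_on with
    | empty => exact ⟨.bot, (gc_eq_bot (fun _ => rfl) u).trans_le bot_le, by simp⟩
    | insert σ F _ ih =>
      obtain ⟨ψ, hψ, hF⟩ := ih
      obtain ⟨χ, hχ, hσ⟩ : ∃ χ, gc χ u ≤ v ∧
          disjT (eval σ (s.conj φ)) (eval σ χ) = eval σ χ := by
        by_cases h₁ : eval σ s = .f
        · refine ⟨.bot, (gc_eq_bot (fun _ => rfl) u).trans_le bot_le, ?_⟩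
          simp [eval, h₁, conjT, disjT]
        by_cases h₂ : eval σ φ = .f
        · refine ⟨.bot, (gc_eq_bot (fun _ => rfl) u).trans_le bot_le, ?_⟩
          simp only [eval, h₂]
          cases eval σ s <;> rfl
        obtain ⟨χ, hχ, hle⟩ := h σ h₁ h₂
        refine ⟨χ, hle, ?_⟩
        simp only [eval, hχ]
        cases eval σ s <;> cases eval σ φ <;> rfl
      refine ⟨χ.disj ψ, (gc_disj χ ψ u).trans_le (sup_le hχ hψ), ?_⟩
      have hassoc : ∀ i j k : V3, disjT i (disjT j k) = disjT (disjT i j) k := by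
        rintro (_ | _ | _) (_ | _ | _) (_ | _ | _) <;> rfl
      have hcomm : ∀ i j : V3, disjT i j = disjT j i := by
        rintro (_ | _ | _) (_ | _ | _) <;> rfl
      intro τ hτ
      change disjT _ (disjT _ _) = disjT _ _
      rcases Finset.mem_insert.1 hτ with rfl | hτ
      · rw [hassoc, hσ]
      · rw [hcomm (eval τ χ), hassoc, hF τ hτ]
  obtain ⟨ψ, hψ, hF⟩ := hcover (Set.finite_univ (α := α → V3)).toFinset
  have hsφ : gc s (gc φ u) ≤ v := by
    rw [gc_gc]
    exact (gc_le_of_disj (fun σ => hF σ (by simp)) u).trans hψ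
  calc gc φ u ≤ sig s ⊔ gc φ u := le_sup_right
    _ = sig s ⊔ gc s (gc φ u) := (sig_sup_gc s _).symm
    _ ≤ v := sup_le hs hsφ

theorem mk_le_of_sim [Finite α] (hγcomm : ∀ a b, γ a b = γ b a) (hγ : ∀ a, γ none a = none)
    {R : APT α Act → APT α Act → Prop} {p q : APT α Act} (h : ASim γ R p q)
    (hR : ∀ p' q', p'.depth < p.depth → q'.depth < q.depth → R p' q' → mk γ p' = mk γ q') :
    mk γ p ≤ mk γ q := by
  have hsig : sig (sigA p) ≤ mk γ q := (sig_congr h.2).trans_le (sig_le_mk q)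
  refine Order.Ideal.mem_principal.1 <|
    (below_mk hγcomm hγ (parCommBelow hγcomm hγ _) p le_rfl).map_mem (f := id)
      (J := .principal (mk γ q)) (fun _ _ => rfl) hsig fun φ a o ht => ?_
  refine Order.Ideal.mem_principal.2 (gc_le_of_forall_val hsig fun σ hs hφ => ?_)
  obtain ⟨ψ, o', hψ, hq, ho⟩ := h.1 φ a o ht σ hs hφ
  have hle := tr_le_mk (parCommBelow hγcomm hγ _) hq le_rfl
  have hd := depth_lt_of_tr ht
  have hd' := depth_lt_of_tr hq
  have hstep : step γ (some a) o = step γ (some a) o' := by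
    cases o <;> cases o'
    · rfl
    · exact ho.elim
    · exact ho.elim
    · exact congrArg (seq (act (some a))) (hR _ _ hd hd' ho)
  exact ⟨ψ, hψ, hstep ▸ hle⟩

theorem mk_eq_of_bisim [Finite α] (hγcomm : ∀ a b, γ a b = γ b a) (hγ : ∀ a, γ none a = none)
    {R : APT α Act → APT α Act → Prop} (hR : AIsBisim γ R) :
    ∀ (n : ℕ) (p q : APT α Act), p.depth < n → R p q → mk γ p = mk γ q
  | 0, _, _, hn, _ => absurd hn (Nat.not_lt_zero _)
  | n + 1, p, q, hn, h =>
    le_antisymm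
      (mk_le_of_sim hγcomm hγ (hR p q h).1 fun p' q' hp _ h' =>
        mk_eq_of_bisim hγcomm hγ hR n p' q' (by omega) h')
      (mk_le_of_sim hγcomm hγ (hR p q h).2 fun q' p' _ hp h' =>
        (mk_eq_of_bisim hγcomm hγ hR n p' q' (by omega) h').symm)

end PCls

/-- Completeness of ctACPps with respect to bisimulation equivalence. -/
theorem ctACPps_completeness {α Act : Type} [Fintype α] [Fintype Act]
    (γ : Option Act → Option Act → Option Act)
    (hγcomm : ∀ a b, γ a b = γ b a)
    (hγassoc : ∀ a b c, γ (γ a b) c = γ a (γ b c))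
    (hγdelta : ∀ a, γ none a = none)
    (p q : APT α Act) (h : ABisim γ p q) : ADeriv γ p q := by
  obtain ⟨R, hR, hpq⟩ := h
  exact PCls.mk_eq_mk.1 (PCls.mk_eq_of_bisim hγcomm hγdelta hR _ p q (Nat.lt_succ_self _) hpq)
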